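/- For every n with n = 0 or n ≥ 2, the pattern of types of the first s_n vertices of row n+1 of the hyperbolic Pascal triangle {4,5} coincides with the pattern of types of row n, where in both rows winger vertices are counted as type B; that is, for each 0 ≤ k < s_n, the k-th vertex of row n+1 has type A if and only if the k-th vertex of row n has type A. -/

import Mathlib

/-- Type of a vertex in a hyperbolic Pascal triangle: winger, A, or B. -/
inductive HVType where
  | W : HVType
  | A : HVType
  | B : HVType
deriving DecidableEq, Repr

/-- Number of type-B children produced by a vertex of the given type
in the hyperbolic Pascal triangle `{4,q}`. -/
def hBCount (q : ℕ) : HVType → ℕ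
  | .A => q - 4
  | .B => q - 3
  | .W => 0

/-- The inner part of the next row: for each pair of consecutive vertices a shared
type-A child whose value is the sum of the parents' values, followed by the
type-B copies of the right parent. -/
def hMid (q : ℕ) : List (HVType × ℕ) → List (HVType × ℕ)
  | a :: b :: rest =>
      (HVType.A, a.2 + b.2) ::
        (List.replicate (hBCount q b.1) (HVType.B, b.2) ++ hMid q (b :: rest))
  | _ => []

/-- Row `n` of the hyperbolic Pascal triangle `{4,q}`, as a list of
(type, value) pairs read from left to right. -/
def hRow (q : ℕ) : ℕ → List (HVType × ℕ)
  | 0 => [(HVType.W, 1)]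
  | n + 1 => (HVType.W, 1) :: (hMid q (hRow q n) ++ [(HVType.W, 1)])

/-- Number of type-A vertices of row `n`. -/
def hCountA (q n : ℕ) : ℕ := ((hRow q n).filter (fun v => v.1 = HVType.A)).length

/-- Number of type-B vertices of row `n`. -/
def hCountB (q n : ℕ) : ℕ := ((hRow q n).filter (fun v => v.1 = HVType.B)).length

/-- Sum of the values of the type-A vertices of row `n`. -/
def hSumA (q n : ℕ) : ℕ :=
  (((hRow q n).filter (fun v => v.1 = HVType.A)).map Prod.snd).sum

/-- Sum of the values of the type-B vertices of row `n`. -/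
def hSumB (q n : ℕ) : ℕ :=
  (((hRow q n).filter (fun v => v.1 = HVType.B)).map Prod.snd).sum

/-- The number `s_n` of vertices of row `n`. -/
def hLen (q n : ℕ) : ℕ := (hRow q n).length

/-- The value of the `k`-th (0-indexed) vertex of row `n`. -/
def hVal (q n k : ℕ) : ℕ := ((hRow q n).getD k (HVType.W, 0)).2

/-- The type of the `k`-th (0-indexed) vertex of row `n`. -/
def hType (q n k : ℕ) : HVType := ((hRow q n).getD k (HVType.W, 0)).1

/-- The types of the vertices of row `n + 1` strictly between its two wingers. -/
def hInner (q n : ℕ) : List HVType := (hMid q (hRow q n)).map Prod.fst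

/-- The types of a shared child followed by the type-B children of its right parent. -/
def hBlock (q : ℕ) (t : HVType) : List HVType :=
  HVType.A :: List.replicate (hBCount q t) HVType.B

theorem map_fst_hMid (q : ℕ) (a : HVType × ℕ) (l : List (HVType × ℕ)) :
    (hMid q (a :: l)).map Prod.fst = (l.map Prod.fst).flatMap (hBlock q) := by
  induction l generalizing a with
  | nil => simp [hMid]
  | cons b l ih => simp [hMid, hBlock, ih]

theorem hInner_succ (q n : ℕ) :
    hInner q (n + 1) = (hInner q n).flatMap (hBlock q) ++ [HVType.A] := by
  simp only [hInner, hRow, map_fst_hMid]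
  simp [hBlock, hBCount]

theorem map_fst_hRow_succ (q n : ℕ) :
    (hRow q (n + 1)).map Prod.fst = HVType.W :: (hInner q n ++ [HVType.W]) := by
  simp [hRow, hInner]

theorem hType_eq_getD (q n k : ℕ) :
    hType q n k = ((hRow q n).map Prod.fst).getD k HVType.W := by
  simp only [hType, List.getD_eq_getElem?_getD, List.getElem?_map]
  cases (hRow q n)[k]? <;> rfl

/-- The interior of a row, with its right winger read as type B, is a prefix of the
interior of the next row. -/
theorem hInner_append_prefix (n : ℕ) :
    hInner 5 (n + 1) ++ [HVType.B] <+: hInner 5 (n + 2) := by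
  induction n with
  | zero => exact ⟨[HVType.A], rfl⟩
  | succ n ih =>
    obtain ⟨t, ht⟩ := ih
    refine ⟨HVType.B :: (t.flatMap (hBlock 5) ++ [HVType.A]), ?_⟩
    rw [hInner_succ 5 (n + 1), hInner_succ 5 (n + 2), ← ht]
    simp [hBlock, hBCount, List.replicate]

/-- for `n = 0` or `n ≥ 2`, the pattern of types of the first `s_n`
vertices of row `n+1` of the hyperbolic Pascal triangle `{4,5}` coincides with the
pattern of row `n` (wingers counted as type B): the `k`-th vertex of row `n+1` has
type A iff the `k`-th vertex of row `n` has type A. -/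
theorem stmt_14 (n : ℕ) (hn : n = 0 ∨ 2 ≤ n) :
    ∀ k, k < hLen 5 n →
      (hType 5 (n + 1) k = HVType.A ↔ hType 5 n k = HVType.A) := by
  intro k hk
  rcases hn with rfl | hn
  · obtain rfl : k = 0 := by simpa [hLen, hRow] using hk
    decide
  obtain ⟨n, rfl⟩ := Nat.exists_eq_add_of_le' hn
  obtain ⟨t, ht⟩ := hInner_append_prefix n
  have hlen : k < (hInner 5 (n + 1)).length + 2 := by
    have h : (hRow 5 (n + 2)).length = (hInner 5 (n + 1)).length + 2 := by
      simpa using congrArg List.length (map_fst_hRow_succ 5 (n + 1))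
    exact h ▸ hk
  rw [hType_eq_getD, hType_eq_getD, map_fst_hRow_succ, map_fst_hRow_succ, ← ht]
  rcases k with _ | k
  · simp
  rcases Nat.lt_or_ge k (hInner 5 (n + 1)).length with h | h
  · simp [List.getElem?_append_left h]
  · obtain rfl : k = (hInner 5 (n + 1)).length := by omega
    simp
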